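/- For all positive integers r and n there exists a finite set S ⊆ ℚ₊ such that for every coloring C : S → {1,…,r} there exists a vector v = (v₁,…,v_n) ∈ Sⁿ with the property that for every n-family 𝓘, both φ_𝓘(v) and Π_{i∈f(𝓘)} v_i belong to S and C(φ_𝓘(v)) = C(Π_{i∈f(𝓘)} v_i). -/

import Mathlib

/-- An `n`-family: a nonempty finite collection of pairwise disjoint nonempty
subsets of `[n] = {1,…,n}`. -/
def IsNFamily (n : ℕ) (𝓘 : Finset (Finset ℕ)) : Prop :=
  𝓘.Nonempty ∧ (∀ I ∈ 𝓘, I.Nonempty ∧ I ⊆ Finset.Icc 1 n) ∧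
    (∀ I ∈ 𝓘, ∀ J ∈ 𝓘, I ≠ J → Disjoint I J)

/-- `L = f(𝓘)`: the member of `𝓘` whose maximum exceeds the maximum of every
other member. -/
def IsLeading (𝓘 : Finset (Finset ℕ)) (L : Finset ℕ) : Prop :=
  L ∈ 𝓘 ∧ ∀ I ∈ 𝓘, I ≠ L → I.max < L.max

/-- `φ_𝓘(v) = Σ_{I ∈ 𝓘} Π_{i ∈ I} v i`. -/
def phi (𝓘 : Finset (Finset ℕ)) (v : ℕ → ℚ) : ℚ := ∑ I ∈ 𝓘, ∏ i ∈ I, v i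

open Polynomial

/-- Compactness for finite systems of equalities between colors. -/
lemma compactness_eq {X ι κ : Type} [Finite κ] (E : ι → Finset (X × X))
    (h : ∀ C : X → κ, ∃ i, ∀ e ∈ E i, C e.1 = C e.2) :
    ∃ I : Finset ι, ∀ C : X → κ, ∃ i ∈ I, ∀ e ∈ E i, C e.1 = C e.2 := by
  classical
  letI : TopologicalSpace κ := ⊥
  haveI : DiscreteTopology κ := ⟨rfl⟩
  have hopen : ∀ i, IsOpen {C : X → κ | ∀ e ∈ E i, C e.1 = C e.2} := by
    intro i
    have : {C : X → κ | ∀ e ∈ E i, C e.1 = C e.2} =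
        ⋂ e ∈ E i, {C : X → κ | C e.1 = C e.2} := by
      ext C; simp
    rw [this]
    refine isOpen_biInter_finset ?_
    intro e _
    have hc : Continuous (fun C : X → κ => (C e.1, C e.2)) :=
      (continuous_apply e.1).prodMk (continuous_apply e.2)
    exact (isOpen_discrete {p : κ × κ | p.1 = p.2}).preimage hc
  obtain ⟨I, hI⟩ := isCompact_univ.elim_finite_subcover _ hopen (by
    intro C _
    obtain ⟨i, hi⟩ := h C
    exact Set.mem_iUnion.2 ⟨i, hi⟩)
  refine ⟨I, fun C => ?_⟩
  have := hI (Set.mem_univ C)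
  simpa using this

section PET
variable {R : Type} [CommRing R]

/-- The conclusion of polynomial van der Waerden for one coloring. -/
def PGood {κ : Type} (A : Finset R[X]) (C : R → κ) : Prop :=
  ∃ z : R, ∃ d : ℕ, 0 < d ∧ ∀ p ∈ A, C (z + p.eval (d : R)) = C z

lemma pgood_finite {κ : Type} [Finite κ] (A : Finset R[X]) (h : ∀ C : R → κ, PGood A C) :
    ∃ I : Finset (R × ℕ), ∀ C : R → κ, ∃ i ∈ I, 0 < i.2 ∧
      ∀ p ∈ A, C (i.1 + p.eval (i.2 : R)) = C i.1 := by
  classical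
  obtain ⟨I, hI⟩ := compactness_eq (X := R) (κ := κ) (ι := R × {d : ℕ // 0 < d})
    (fun i => A.image (fun p => (i.1 + p.eval ((i.2 : ℕ) : R), i.1))) (by
      intro C
      obtain ⟨z, d, hd, h⟩ := h C
      refine ⟨(z, ⟨d, hd⟩), ?_⟩
      intro e he
      obtain ⟨p, hp, rfl⟩ := Finset.mem_image.1 he
      exact h p hp)
  refine ⟨I.image (fun i => (i.1, (i.2 : ℕ))), fun C => ?_⟩
  obtain ⟨i, hi, h⟩ := hI C
  refine ⟨_, Finset.mem_image_of_mem _ hi, i.2.2, fun p hp => ?_⟩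
  exact h _ (Finset.mem_image_of_mem _ hp)

/-- The derived polynomial. -/
noncomputable def derP (p1 p : R[X]) (j : ℕ) : R[X] :=
  taylor (j : R) p - C (p.eval (j : R)) - p1

lemma derP_eval (p1 p : R[X]) (j d : ℕ) :
    (derP p1 p j).eval (d : R) = p.eval ((d + j : ℕ) : R) - p.eval (j : R) - p1.eval (d : R) := by
  simp [derP, taylor_eval]

/-- Color focusing. -/
lemma focus {κ : Type} [Finite κ] (A : Finset R[X]) (p1 : R[X]) (hp1 : p1 ∈ A)
    (h0 : ∀ p ∈ A, p.coeff 0 = 0)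
    (IH : ∀ D : Finset ℕ, ∀ κ' : Type, Finite κ' → ∀ C : R → κ', ∃ z : R, ∃ d : ℕ, 0 < d ∧
      ∀ p ∈ A, ∀ j ∈ D, C (z + (derP p1 p j).eval (d : R)) = C z)
    (s : ℕ) : ∃ (W : Finset R) (D : Finset ℕ), ∀ C : R → κ, PGood A C ∨
      ∃ a ∈ W, ∃ ds ⊆ D, ds.card = s ∧ (∀ d ∈ ds, 0 < d) ∧
        (∀ d ∈ ds, ∀ p ∈ A, C (a + p.eval (d : R)) = C (a + p1.eval (d : R))) ∧
        (∀ d ∈ ds, ∀ d' ∈ ds, C (a + p1.eval (d : R)) = C (a + p1.eval (d' : R)) → d = d') := by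
  classical
  induction s with
  | zero =>
    refine ⟨{0}, ∅, fun C => Or.inr ⟨0, by simp, ∅, by simp, by simp⟩⟩
  | succ s ih =>
    obtain ⟨W, D, hF⟩ := ih
    let W2 : Finset R := W ∪ (W ×ˢ (A ×ˢ D)).image (fun x => x.1 + x.2.1.eval (x.2.2 : R))
    have hW2 : ∀ a ∈ W, a ∈ W2 := fun a ha => Finset.mem_union_left _ ha
    have hW2' : ∀ a ∈ W, ∀ p ∈ A, ∀ d ∈ D, a + p.eval (d : R) ∈ W2 := by
      intro a ha p hp d hd
      refine Finset.mem_union_right _ (Finset.mem_image.2 ⟨(a, p, d), ?_, rfl⟩)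
      simp [ha, hp, hd]
    let D0 : Finset ℕ := insert 0 D
    let A' : Finset R[X] := (A ×ˢ D0).image (fun x => derP p1 x.1 x.2)
    obtain ⟨I, hI⟩ := pgood_finite (κ := W2 → κ) A' (by
      intro C
      obtain ⟨z, d, hd, h⟩ := IH D0 _ inferInstance C
      refine ⟨z, d, hd, ?_⟩
      intro q hq
      obtain ⟨⟨p, j⟩, hx, rfl⟩ := Finset.mem_image.1 hq
      obtain ⟨h1, h2⟩ := Finset.mem_product.1 hx
      exact h p h1 j h2)
    refine ⟨(I ×ˢ W).image (fun x => x.1.1 + x.2 - p1.eval (x.1.2 : R)),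
      I.image Prod.snd ∪ (I ×ˢ D).image (fun x => x.1.2 + x.2), fun C => ?_⟩
    obtain ⟨⟨a', d⟩, hi, hd, hcol⟩ := hI (fun y w => C (y + w))
    simp only at hd hcol
    have key : ∀ p ∈ A, ∀ j ∈ D0, ∀ w ∈ W2,
        C (a' + (derP p1 p j).eval (d : R) + w) = C (a' + w) := by
      intro p hp j hj w hw
      have := hcol (derP p1 p j) (Finset.mem_image.2 ⟨(p, j), Finset.mem_product.2 ⟨hp, hj⟩, rfl⟩)
      exact congrFun this ⟨w, hw⟩
    rcases hF (fun y => C (a' + y)) with ⟨z, e, he, h⟩ | ⟨a, ha, ds, hds, hcard, hpos, hmono, hinj⟩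
    · left
      refine ⟨a' + z, e, he, fun p hp => ?_⟩
      have := h p hp
      simpa [add_assoc] using this
    by_cases hex : ∃ j ∈ ds, C (a' + (a + p1.eval (j : R))) = C (a' + a)
    · left
      obtain ⟨j, hj, hc⟩ := hex
      refine ⟨a' + a, j, hpos j hj, fun p hp => ?_⟩
      have := hmono j hj p hp
      rw [add_assoc, this, hc]
    push Not at hex
    right
    have e1 : ∀ p ∈ A, ∀ j ∈ ds, C (a' + a - p1.eval (d : R) + p.eval ((d + j : ℕ) : R)) =
        C (a' + (a + p.eval (j : R))) := by
      intro p hp j hj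
      rw [← key p hp j (Finset.mem_insert_of_mem (hds hj)) _ (hW2' a ha p hp j (hds hj)), derP_eval]
      congr 1; ring
    have e2 : ∀ p ∈ A, C (a' + a - p1.eval (d : R) + p.eval (d : R)) = C (a' + a) := by
      intro p hp
      rw [← key p hp 0 (Finset.mem_insert_self _ _) a (hW2 a ha), derP_eval]
      have : p.eval ((0 : ℕ) : R) = 0 := by
        rw [Nat.cast_zero, ← coeff_zero_eq_eval_zero, h0 p hp]
      rw [this]
      congr 1; simp; ring
    refine ⟨a' + a - p1.eval (d : R), Finset.mem_image.2 ⟨((a', d), a), by simp [hi, ha], rfl⟩,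
      insert d (ds.image (fun j => d + j)), ?_, ?_, ?_, ?_, ?_⟩
    · intro x hx
      rcases Finset.mem_insert.1 hx with rfl | hx
      · exact Finset.mem_union_left _ (Finset.mem_image.2 ⟨_, hi, rfl⟩)
      · obtain ⟨j, hj, rfl⟩ := Finset.mem_image.1 hx
        exact Finset.mem_union_right _ (Finset.mem_image.2 ⟨((a', d), j), by simp [hi, hds hj], rfl⟩)
    · rw [Finset.card_insert_of_notMem, Finset.card_image_of_injective _ (add_right_injective d), hcard]
      intro hx
      obtain ⟨j, hj, hh⟩ := Finset.mem_image.1 hx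
      have := hpos j hj
      omega
    · intro x hx
      rcases Finset.mem_insert.1 hx with rfl | hx
      · exact hd
      · obtain ⟨j, hj, rfl⟩ := Finset.mem_image.1 hx
        omega
    · intro x hx p hp
      rcases Finset.mem_insert.1 hx with rfl | hx
      · rw [e2 p hp, e2 p1 hp1]
      · obtain ⟨j, hj, rfl⟩ := Finset.mem_image.1 hx
        rw [e1 p hp j hj, e1 p1 hp1 j hj]
        exact hmono j hj p hp
    · intro x hx y hy hxy
      rcases Finset.mem_insert.1 hx with rfl | hx <;> rcases Finset.mem_insert.1 hy with rfl | hy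
      · rfl
      · obtain ⟨j, hj, rfl⟩ := Finset.mem_image.1 hy
        rw [e2 p1 hp1, e1 p1 hp1 j hj] at hxy
        exact absurd hxy.symm (hex j hj)
      · obtain ⟨j, hj, rfl⟩ := Finset.mem_image.1 hx
        rw [e2 p1 hp1, e1 p1 hp1 j hj] at hxy
        exact absurd hxy (hex j hj)
      · obtain ⟨j, hj, rfl⟩ := Finset.mem_image.1 hx
        obtain ⟨j', hj', rfl⟩ := Finset.mem_image.1 hy
        rw [e1 p1 hp1 j hj, e1 p1 hp1 j' hj'] at hxy
        rw [hinj j hj j' hj' hxy]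

lemma focus_good {κ : Type} [Finite κ] (A : Finset R[X]) (p1 : R[X]) (hp1 : p1 ∈ A)
    (h0 : ∀ p ∈ A, p.coeff 0 = 0)
    (IH : ∀ D : Finset ℕ, ∀ κ' : Type, Finite κ' → ∀ C : R → κ', ∃ z : R, ∃ d : ℕ, 0 < d ∧
      ∀ p ∈ A, ∀ j ∈ D, C (z + (derP p1 p j).eval (d : R)) = C z)
    (C : R → κ) : PGood A C := by
  classical
  haveI := Fintype.ofFinite κ
  obtain ⟨W, D, h⟩ := focus (κ := κ) A p1 hp1 h0 IH (Fintype.card κ + 1)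
  rcases h C with h | ⟨a, -, ds, -, hcard, -, -, hinj⟩
  · exact h
  · exfalso
    have := Finset.card_le_card_of_injOn (s := ds) (t := Finset.univ)
      (fun d => C (a + p1.eval (d : R))) (by simp) (by
        intro x hx y hy hxy; exact hinj x hx y hy hxy)
    rw [hcard, Finset.card_univ] at this
    omega

end PET

section PET2
variable {R : Type} [CommRing R]

open Classical in
/-- Leading coefficients of the members of degree `t`. -/
noncomputable def cls (A : Finset R[X]) (t : ℕ) : Finset R :=
  (A.filter (fun p => p.natDegree = t)).image leadingCoeff

open Classical in
/-- The weight of a system. -/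
noncomputable def wt (A : Finset R[X]) : ℕ →₀ ℕ :=
  Finsupp.onFinset (A.image natDegree) (fun t => (cls A t).card) (by
    intro t ht
    have : (cls A t).Nonempty := Finset.card_pos.1 (Nat.pos_of_ne_zero ht)
    obtain ⟨c, hc⟩ := this
    obtain ⟨p, hp, -⟩ := Finset.mem_image.1 hc
    obtain ⟨h1, h2⟩ := Finset.mem_filter.1 hp
    exact Finset.mem_image.2 ⟨p, h1, h2⟩)

lemma mem_cls {A : Finset R[X]} {t : ℕ} {c : R} :
    c ∈ cls A t ↔ ∃ p ∈ A, p.natDegree = t ∧ p.leadingCoeff = c := by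
  classical
  simp [cls, and_assoc]

lemma wt_apply (A : Finset R[X]) (t : ℕ) : wt A t = (cls A t).card := rfl

lemma derP_natDegree_le (p1 p : R[X]) (j : ℕ) (h : p1.natDegree ≤ p.natDegree) :
    (derP p1 p j).natDegree ≤ p.natDegree := by
  unfold derP
  refine (natDegree_sub_le _ _).trans (max_le ?_ h)
  refine (natDegree_sub_le _ _).trans (max_le ?_ ?_)
  · rw [natDegree_taylor]
  · simp

lemma derP_coeff (p1 p : R[X]) (j : ℕ) (h : 0 < p.natDegree) :
    (derP p1 p j).coeff p.natDegree = p.leadingCoeff - p1.coeff p.natDegree := by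
  unfold derP
  rw [coeff_sub, coeff_sub, coeff_taylor_natDegree, coeff_C_of_ne_zero (by omega), sub_zero]

lemma derP_coeff_zero (p1 p : R[X]) (j : ℕ) (h : p1.coeff 0 = 0) :
    (derP p1 p j).coeff 0 = 0 := by
  unfold derP
  simp [h, taylor_coeff_zero]

lemma derP_lt (p1 p : R[X]) (j : ℕ) (h : p1.natDegree < p.natDegree) :
    (derP p1 p j).natDegree = p.natDegree ∧ (derP p1 p j).leadingCoeff = p.leadingCoeff := by
  have h1 := derP_natDegree_le p1 p j h.le
  have h2 := derP_coeff p1 p j (by omega)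
  rw [coeff_eq_zero_of_natDegree_lt h, sub_zero] at h2
  have h3 : (derP p1 p j).natDegree = p.natDegree := by
    refine le_antisymm h1 (le_natDegree_of_ne_zero ?_)
    rw [h2]
    intro h0
    rw [leadingCoeff_eq_zero] at h0
    simp [h0] at h
  refine ⟨h3, ?_⟩
  rw [leadingCoeff, h3, h2]

theorem poly_vdw (A : Finset R[X]) (hne : ∀ p ∈ A, p ≠ 0) (h0 : ∀ p ∈ A, p.coeff 0 = 0) :
    ∀ κ : Type, Finite κ → ∀ C : R → κ, PGood A C := by
  classical
  have wf : WellFounded (Finsupp.Lex (fun a b : ℕ => b < a) (fun a b : ℕ => a < b)) :=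
    haveI : Std.Trichotomous (fun a b : ℕ => b < a) := ⟨fun a b h1 h2 => by omega⟩
    Finsupp.Lex.wellFounded' (by intro n; simp) wellFounded_lt wellFounded_lt
  have main : ∀ w : ℕ →₀ ℕ, ∀ A : Finset R[X], wt A = w → (∀ p ∈ A, p ≠ 0) →
      (∀ p ∈ A, p.coeff 0 = 0) → ∀ κ : Type, Finite κ → ∀ C : R → κ, PGood A C := by
    intro w
    induction w using wf.induction with
    | _ w ih =>
    intro A hw hne h0 κ hκ C
    rcases A.eq_empty_or_nonempty with rfl | hA
    · exact ⟨0, 1, one_pos, by simp⟩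
    obtain ⟨p1, hp1, hmin⟩ := Finset.exists_min_image A natDegree hA
    have hdeg : ∀ p ∈ A, 0 < p.natDegree := by
      intro p hp
      rw [Nat.pos_iff_ne_zero]
      intro hz
      apply hne p hp
      rw [eq_C_of_natDegree_eq_zero hz, h0 p hp, C_0]
    refine focus_good A p1 hp1 h0 ?_ C
    intro D κ' hκ' C'
    let A' : Finset R[X] := ((A ×ˢ insert 0 D).image (fun x => derP p1 x.1 x.2)).filter (· ≠ 0)
    have hA' : ∀ q, q ∈ A' ↔ (∃ p ∈ A, ∃ j ∈ insert 0 D, derP p1 p j = q) ∧ q ≠ 0 := by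
      intro q
      simp only [A', Finset.mem_filter, Finset.mem_image, Finset.mem_product, Prod.exists]
      constructor
      · rintro ⟨⟨p, j, ⟨h1, h2⟩, h3⟩, h4⟩; exact ⟨⟨p, h1, j, h2, h3⟩, h4⟩
      · rintro ⟨⟨p, h1, j, h2, h3⟩, h4⟩; exact ⟨⟨p, j, ⟨h1, h2⟩, h3⟩, h4⟩
    have hlex : Finsupp.Lex (fun a b : ℕ => b < a) (fun a b : ℕ => a < b) (wt A') w := by
      refine ⟨p1.natDegree, ?_, ?_⟩
      · intro t ht
        change (wt A') t = w t
        rw [← hw, wt_apply, wt_apply]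
        congr 1
        ext c
        rw [mem_cls, mem_cls]
        constructor
        · rintro ⟨q, hq, hqt, hqc⟩
          obtain ⟨⟨p, hp, j, hj, rfl⟩, hq0⟩ := (hA' q).1 hq
          have h1 := derP_natDegree_le p1 p j (hmin p hp)
          have h2 := derP_lt p1 p j (by omega)
          exact ⟨p, hp, by rw [← h2.1, hqt], by rw [← h2.2, hqc]⟩
        · rintro ⟨p, hp, hpt, hpc⟩
          have h2 := derP_lt p1 p 0 (by omega)
          refine ⟨derP p1 p 0, (hA' _).2 ⟨⟨p, hp, 0, by simp, rfl⟩, ?_⟩, by rw [h2.1, hpt],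
            by rw [h2.2, hpc]⟩
          intro hz
          rw [hz] at h2
          have := hdeg p hp
          simp at h2
          omega
      · change (wt A') p1.natDegree < w p1.natDegree
        rw [← hw, wt_apply, wt_apply]
        have hsub : cls A' p1.natDegree ⊆
            ((cls A p1.natDegree).erase p1.leadingCoeff).image (fun c => c - p1.leadingCoeff) := by
          intro c hc
          obtain ⟨q, hq, hqt, hqc⟩ := mem_cls.1 hc
          obtain ⟨⟨p, hp, j, hj, rfl⟩, hq0⟩ := (hA' q).1 hq
          have hpt : p.natDegree = p1.natDegree := by
            rcases (hmin p hp).lt_or_eq with h | h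
            · have := (derP_lt p1 p j h).1
              omega
            · exact h.symm
          have hco := derP_coeff p1 p j (hdeg p hp)
          have hcc : c = p.leadingCoeff - p1.leadingCoeff := by
            rw [← hqc, leadingCoeff, hqt, ← hpt, hco, hpt]; rfl
          refine Finset.mem_image.2 ⟨p.leadingCoeff, Finset.mem_erase.2 ⟨?_, ?_⟩, hcc.symm⟩
          · intro h
            apply hq0
            rw [← leadingCoeff_eq_zero, hqc, hcc, h, sub_self]
          · exact mem_cls.2 ⟨p, hp, hpt, rfl⟩
        have hmem : p1.leadingCoeff ∈ cls A p1.natDegree := mem_cls.2 ⟨p1, hp1, rfl, rfl⟩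
        calc _ ≤ _ := Finset.card_le_card hsub
          _ ≤ _ := Finset.card_image_le
          _ < _ := Finset.card_erase_lt_of_mem hmem
    obtain ⟨z, d, hd, h⟩ := ih _ hlex A' rfl (fun q hq => ((hA' q).1 hq).2) (by
      intro q hq
      obtain ⟨⟨p, hp, j, hj, rfl⟩, hq0⟩ := (hA' q).1 hq
      exact derP_coeff_zero p1 p j (h0 p1 hp1)) κ' hκ' C'
    refine ⟨z, d, hd, fun p hp j hj => ?_⟩
    by_cases hz : derP p1 p j = 0
    · simp [hz]
    · exact h _ ((hA' _).2 ⟨⟨p, hp, j, Finset.mem_insert_of_mem hj, rfl⟩, hz⟩)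
  exact main _ A rfl hne h0

theorem poly_vdw' (A : Finset R[X]) (h0 : ∀ p ∈ A, p.coeff 0 = 0)
    {κ : Type} [Finite κ] (C : R → κ) : PGood A C := by
  classical
  obtain ⟨z, d, hd, h⟩ := poly_vdw (A.filter (· ≠ 0)) (by simp)
    (fun p hp => h0 p (Finset.mem_filter.1 hp).1) κ inferInstance C
  refine ⟨z, d, hd, fun p hp => ?_⟩
  by_cases hz : p = 0
  · simp [hz]
  · exact h p (Finset.mem_filter.2 ⟨hp, hz⟩)

end PET2

/-- The universal coefficient group. -/
abbrev GR (ι : Type) (M : ℕ) : Type := ι × Fin (M + 1) → ℤ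

/-- Uniform polynomial van der Waerden. -/
theorem pv_uniform (ι κ : Type) [Finite ι] [Finite κ] (M : ℕ) :
    ∃ (U : Type) (_ : Finite U) (d : U → ℕ), (∀ u, 0 < d u) ∧
      ∀ f : ι → ℚ[X], (∀ i, (f i).natDegree ≤ M) → (∀ i, (f i).coeff 0 = 0) →
        ∃ Z : U → ℚ[X], (∀ u, (Z u).natDegree ≤ M) ∧
          ∀ (C : ℚ → κ) (δ : ℚ), ∃ u, ∀ i,
            C ((Z u).eval δ + (f i).eval (δ * d u)) = C ((Z u).eval δ) := by
  classical
  have := Fintype.ofFinite ι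
  let P : ι → (GR ι M)[X] := fun i => ∑ j : Fin (M + 1),
    if (j : ℕ) = 0 then 0 else monomial (j : ℕ) (Pi.single (i, j) 1 : GR ι M)
  let A : Finset (GR ι M)[X] := Finset.univ.image P
  have hP0 : ∀ p ∈ A, p.coeff 0 = 0 := by
    intro p hp
    obtain ⟨i, -, rfl⟩ := Finset.mem_image.1 hp
    simp only [P, finsetSum_coeff]
    refine Finset.sum_eq_zero fun j _ => ?_
    split_ifs with h
    · simp
    · rw [coeff_monomial, if_neg h]
  obtain ⟨I, hI⟩ := pgood_finite (κ := κ) A (fun C => poly_vdw' A hP0 C)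
  let U := {u : GR ι M × ℕ // u ∈ I ∧ 0 < u.2}
  refine ⟨U, ?_, fun u => u.1.2, fun u => u.2.2, ?_⟩
  · exact Finite.of_injective (β := I) (fun u => ⟨u.1, u.2.1⟩) (by
      intro a b h; exact Subtype.ext (congrArg (fun x : I => (x : GR ι M × ℕ)) h))
  intro f hf hf0
  let L : GR ι M →+ ℚ[X] :=
    { toFun := fun g => ∑ x : ι × Fin (M + 1), monomial (x.2 : ℕ) ((g x : ℚ) * (f x.1).coeff x.2)
      map_zero' := by simp
      map_add' := by
        intro g h
        rw [← Finset.sum_add_distrib]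
        refine Finset.sum_congr rfl fun x _ => ?_
        rw [← map_add]
        congr 1
        simp only [Pi.add_apply]
        push_cast
        ring }
  have hL : ∀ g, L g = ∑ x : ι × Fin (M + 1), monomial (x.2 : ℕ) ((g x : ℚ) * (f x.1).coeff x.2) :=
    fun g => rfl
  have hLP : ∀ i (d : ℕ) (δ : ℚ), (L ((P i).eval (d : GR ι M))).eval δ = (f i).eval (δ * d) := by
    intro i d δ
    have e1 : (f i).eval (δ * d) = ∑ j : Fin (M + 1), (f i).coeff j * (δ * d) ^ (j : ℕ) := by
      rw [eval_eq_sum_range' (Nat.lt_succ_of_le (hf i)), Finset.sum_range]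
    have e2 : (P i).eval (d : GR ι M) = ∑ j : Fin (M + 1),
        if (j : ℕ) = 0 then 0 else (Pi.single (i, j) 1 : GR ι M) * (d : GR ι M) ^ (j : ℕ) := by
      simp only [P, eval_finsetSum]
      refine Finset.sum_congr rfl fun j _ => ?_
      split_ifs <;> simp
    rw [e1, e2, map_sum, eval_finsetSum]
    refine Finset.sum_congr rfl fun j _ => ?_
    split_ifs with h
    · rw [map_zero, h, hf0 i]; simp
    · rw [hL, eval_finsetSum, Finset.sum_eq_single (i, j)]
      · simp only [eval_monomial, Pi.mul_apply, Pi.single_eq_same, Pi.pow_apply, Pi.natCast_apply]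
        push_cast
        ring
      · intro b _ hb
        simp [Pi.single_eq_of_ne hb]
      · simp
  refine ⟨fun u => L u.1.1, ?_, ?_⟩
  · intro u
    simp only [hL]
    refine natDegree_sum_le_of_forall_le _ _ fun x _ => ?_
    refine (natDegree_monomial_le _).trans ?_
    exact Nat.le_of_lt_succ x.2.2
  · intro C δ
    obtain ⟨u, hu, hpos, h⟩ := hI (fun g => C ((L g).eval δ))
    refine ⟨⟨u, hu, hpos⟩, fun i => ?_⟩
    have := h (P i) (Finset.mem_image_of_mem _ (Finset.mem_univ i))
    rw [map_add, eval_add, hLP] at this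
    exact this

/-- Subsets of `[N]`. -/
abbrev BsT (N : ℕ) : Type := {B : Finset ℕ // B ∈ (Finset.Icc 1 N).powerset}

/-- Elements of a finite set of rationals. -/
abbrev AsT (A : Finset ℚ) : Type := {a : ℚ // a ∈ A}

/-- Collections of nonempty subsets of `[N]`. -/
abbrev JsT (N : ℕ) : Type :=
  {J : Finset (Finset ℕ) // J ∈ ((Finset.Icc 1 N).powerset.erase ∅).powerset}

/-- `phi` of a dilated vector as a polynomial in the dilation. -/
noncomputable def phiP (J : Finset (Finset ℕ)) (v : ℕ → ℚ) : ℚ[X] :=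
  ∑ I ∈ J, monomial I.card (∏ i ∈ I, v i)

lemma phiP_eval (J : Finset (Finset ℕ)) (v : ℕ → ℚ) (b : ℚ) :
    (phiP J v).eval b = phi J (fun i => b * v i) := by
  simp only [phiP, phi, eval_finsetSum, eval_monomial]
  refine Finset.sum_congr rfl fun I _ => ?_
  rw [Finset.prod_mul_distrib, Finset.prod_const]
  ring

lemma phiP_natDegree {N : ℕ} {J : Finset (Finset ℕ)} (v : ℕ → ℚ)
    (hJ : J ⊆ (Finset.Icc 1 N).powerset.erase ∅) : (phiP J v).natDegree ≤ N := by
  refine natDegree_sum_le_of_forall_le _ _ fun I hI => ?_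
  refine (natDegree_monomial_le _).trans ?_
  have := Finset.card_le_card (Finset.mem_powerset.1 (Finset.mem_of_mem_erase (hJ hI)))
  simpa using this

lemma phiP_coeff_zero {N : ℕ} {J : Finset (Finset ℕ)} (v : ℕ → ℚ)
    (hJ : J ⊆ (Finset.Icc 1 N).powerset.erase ∅) : (phiP J v).coeff 0 = 0 := by
  rw [phiP, finsetSum_coeff]
  refine Finset.sum_eq_zero fun I hI => ?_
  rw [coeff_monomial, if_neg]
  intro h
  exact Finset.ne_of_mem_erase (hJ hI) (Finset.card_eq_zero.1 h)

theorem stage (N : ℕ) (κ : Type) [Finite κ] (A : Finset ℚ) (hA : ∀ a ∈ A, 0 < a) (k : ℕ) :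
    ∃ (T : Type) (_ : Finite T) (d l : T → ℚ) (M : ℕ), (∀ t, 0 < d t) ∧ (∀ t, 0 < l t) ∧
      ∀ v : ℕ → ℚ, (∀ i, 0 < v i) → ∃ q : T → ℚ[X], (∀ t, (q t).natDegree ≤ M) ∧
        ∀ (C : ℚ → κ) (δ x0 : ℚ), 0 < δ → ∃ t, ∀ a ∈ A, ∀ B ⊆ Finset.Icc 1 N, B.card < k →
          ∀ J ⊆ (Finset.Icc 1 N).powerset.erase ∅,
          ∀ x, x = l t * x0 + δ * (q t).eval δ / δ ^ k →
            C (a ^ (B.card + 1) * (δ * d t) ^ B.card * (∏ i ∈ B, v i) * x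
              + phi J (fun i => a * (δ * d t) * v i)) =
            C (a ^ (B.card + 1) * (δ * d t) ^ B.card * (∏ i ∈ B, v i) * x) := by
  classical
  induction k with
  | zero =>
    refine ⟨Unit, inferInstance, fun _ => 1, fun _ => 1, 0, by simp, by simp, fun v _ =>
      ⟨fun _ => 0, by simp, fun C δ x0 _ => ⟨(), ?_⟩⟩⟩
    intro a _ B _ hB
    omega
  | succ k ih =>
    obtain ⟨T, hT, d1, l1, M, hd1, hl1, ih⟩ := ih
    obtain ⟨U, hU, d, hd, hpv⟩ := pv_uniform ((BsT N × AsT A × T) × JsT N) (BsT N × AsT A × T → κ) (M + 1 + N)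
    have hdq : ∀ u, (0 : ℚ) < d u := fun u => Nat.cast_pos.2 (hd u)
    refine ⟨U × T, inferInstance, fun t => d t.1 * d1 t.2, fun t => l1 t.2 / (d t.1 : ℚ) ^ k,
      M + 1 + N + (M + 1), ?_, ?_, ?_⟩
    · intro t; exact mul_pos (hdq _) (hd1 _)
    · intro t; exact div_pos (hl1 _) (pow_pos (hdq _) _)
    intro v hv
    obtain ⟨q1, hq1, ih⟩ := ih v hv
    let e : BsT N × AsT A × T → ℚ := fun w =>
      (w.2.1 : ℚ) ^ (k + 1) * d1 w.2.2 ^ k * (∏ i ∈ (w.1 : Finset ℕ), v i) * l1 w.2.2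
    have he : ∀ w, 0 < e w := by
      intro w
      have h1 := hA _ w.2.1.2
      have h2 := hd1 w.2.2
      have h3 := hl1 w.2.2
      have h4 : 0 < ∏ i ∈ (w.1 : Finset ℕ), v i := Finset.prod_pos fun i _ => hv i
      positivity
    let f : (BsT N × AsT A × T) × JsT N → ℚ[X] := fun w =>
      C (l1 w.1.2.2)⁻¹ * (X * q1 w.1.2.2) +
        C (e w.1)⁻¹ * phiP w.2.1 (fun i => (w.1.2.1 : ℚ) * d1 w.1.2.2 * v i)
    obtain ⟨Z, hZ, hpv⟩ := hpv f (by
      intro w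
      refine (natDegree_add_le _ _).trans (max_le ?_ ?_)
      · refine (natDegree_C_mul_le _ _).trans (natDegree_mul_le.trans ?_)
        have := hq1 w.1.2.2
        have := natDegree_X_le (R := ℚ)
        omega
      · refine (natDegree_C_mul_le _ _).trans ?_
        have := phiP_natDegree (fun i => (w.1.2.1 : ℚ) * d1 w.1.2.2 * v i)
          (Finset.mem_powerset.1 w.2.2)
        omega) (by
      intro w
      simp only [f, coeff_add, coeff_C_mul, coeff_X_mul_zero, mul_zero, zero_add]
      rw [phiP_coeff_zero _ (Finset.mem_powerset.1 w.2.2), mul_zero])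
    refine ⟨fun t => C (l1 t.2 / (d t.1 : ℚ) ^ k) * Z t.1 +
      C ((d t.1 : ℚ) / (d t.1 : ℚ) ^ k) * (X * (q1 t.2).comp (C (d t.1 : ℚ) * X)), ?_, ?_⟩
    · intro t
      refine (natDegree_add_le _ _).trans (max_le ?_ ?_)
      · refine (natDegree_C_mul_le _ _).trans ((hZ _).trans (by omega))
      · refine (natDegree_C_mul_le _ _).trans (natDegree_mul_le.trans ?_)
        have h1 := natDegree_X_le (R := ℚ)
        have h2 : ((q1 t.2).comp (C (d t.1 : ℚ) * X)).natDegree ≤ M := by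
          refine natDegree_comp_le.trans ?_
          have h3 : (C (d t.1 : ℚ) * X).natDegree ≤ 1 :=
            (natDegree_C_mul_le _ _).trans natDegree_X_le
          calc _ ≤ (q1 t.2).natDegree * 1 := Nat.mul_le_mul_left _ h3
            _ ≤ M := by rw [mul_one]; exact hq1 _
        omega
    intro Col δ x0 hδ
    obtain ⟨u, hu⟩ := hpv (fun y w => Col (e w * (δ ^ k * x0 + y))) δ
    have hdu := hdq u
    obtain ⟨t, ht⟩ := ih Col (δ * d u) (x0 / (d u : ℚ) ^ k + (Z u).eval δ / (δ * d u) ^ k)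
      (mul_pos hδ hdu)
    refine ⟨(u, t), ?_⟩
    intro a ha B hB hBk J hJ x hx
    have hx1 : x = l1 t * (x0 / (d u : ℚ) ^ k + (Z u).eval δ / (δ * d u) ^ k) +
        δ * d u * (q1 t).eval (δ * d u) / (δ * d u) ^ k := by
      rw [hx]
      simp only [eval_add, eval_mul, eval_C, eval_X, eval_comp]
      rw [mul_comm (d u : ℚ) δ]
      generalize (q1 t).eval (δ * d u) = Q
      generalize (Z u).eval δ = Y
      field_simp
      try ring
    simp only [← mul_assoc δ]
    rcases Nat.lt_succ_iff_lt_or_eq.1 hBk with hlt | heq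
    · exact ht a ha B hB hlt J hJ x hx1
    · let w : BsT N × AsT A × T := (⟨B, Finset.mem_powerset.2 hB⟩, ⟨a, ha⟩, t)
      have hew : e w = a ^ (k + 1) * d1 t ^ k * (∏ i ∈ B, v i) * l1 t := rfl
      have hpos := he w
      have hl := hl1 t
      have k1 := congrFun (hu (w, ⟨J, Finset.mem_powerset.2 hJ⟩)) w
      have k2 := congrFun (hu (w, ⟨∅, by simp⟩)) w
      have f1 : (f (w, ⟨J, Finset.mem_powerset.2 hJ⟩)).eval (δ * d u) =
          (l1 t)⁻¹ * (δ * d u * (q1 t).eval (δ * d u)) +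
          (e w)⁻¹ * phi J (fun i => a * (δ * d u * d1 t) * v i) := by
        simp only [f, eval_add, eval_mul, eval_C, eval_X, phiP_eval]
        congr 4
        ext i
        ring
      have f2 : (f (w, ⟨∅, by simp⟩)).eval (δ * d u) =
          (l1 t)⁻¹ * (δ * d u * (q1 t).eval (δ * d u)) := by
        simp only [f, eval_add, eval_mul, eval_C, eval_X, phiP_eval]
        simp [phi, w]
      simp only [f1] at k1
      simp only [f2] at k2
      have hxx : a ^ (B.card + 1) * (δ * d u * d1 t) ^ B.card * (∏ i ∈ B, v i) * x =
          e w * (δ ^ k * x0 + ((Z u).eval δ + (l1 t)⁻¹ * (δ * d u * (q1 t).eval (δ * d u)))) := by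
        rw [hx1, hew, heq]
        generalize (q1 t).eval (δ * d u) = Q
        field_simp
        try ring
      rw [hxx, k2, ← k1]
      congr 1
      field_simp
      try ring

lemma phi_congr {J : Finset (Finset ℕ)} {v w : ℕ → ℚ} (h : ∀ I ∈ J, ∀ i ∈ I, v i = w i) :
    phi J v = phi J w :=
  Finset.sum_congr rfl fun I hI => Finset.prod_congr rfl fun i hi => h I hI i hi

theorem robust (κ : Type) [Finite κ] (n : ℕ) : ∀ A : Finset ℚ, (∀ a ∈ A, 0 < a) →
    ∀ C : ℚ → κ, ∃ v : ℕ → ℚ, (∀ i, 0 < v i) ∧ ∀ a ∈ A, ∀ 𝓘 : Finset (Finset ℕ),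
      IsNFamily n 𝓘 → ∀ F, IsLeading 𝓘 F →
        C (phi 𝓘 (fun i => a * v i)) = C (∏ i ∈ F, a * v i) := by
  classical
  induction n with
  | zero =>
    intro A _ C
    refine ⟨fun _ => 1, by simp, ?_⟩
    intro a _ 𝓘 h F hF
    obtain ⟨h1, h2⟩ := h.2.1 F hF.1
    obtain ⟨i, hi⟩ := h1
    have := Finset.mem_Icc.1 (h2 hi)
    omega
  | succ N ih =>
    intro A hA C
    obtain ⟨T, hT, d, l, M, hd, hl, hS⟩ := stage N κ A hA (N + 1)
    have := Fintype.ofFinite T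
    obtain ⟨v, hv, hcons⟩ := ih ((A ×ˢ Finset.univ).image (fun x : ℚ × T => x.1 * d x.2)) (by
      intro b hb
      obtain ⟨x, hx, rfl⟩ := Finset.mem_image.1 hb
      exact mul_pos (hA _ (Finset.mem_product.1 hx).1) (hd _)) C
    obtain ⟨q, -, hS⟩ := hS v hv
    let x0 : ℚ := ∑ t, |(q t).eval 1| / l t + 1
    obtain ⟨t, ht⟩ := hS C 1 x0 one_pos
    let x : ℚ := l t * x0 + (q t).eval 1
    have hx : 0 < x := by
      have h1 : |(q t).eval 1| / l t ≤ ∑ t, |(q t).eval 1| / l t :=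
        Finset.single_le_sum (f := fun t => |(q t).eval 1| / l t)
          (fun s _ => div_nonneg (abs_nonneg _) (hl s).le) (Finset.mem_univ t)
      have h2 : l t * (|(q t).eval 1| / l t + 1) ≤ l t * x0 :=
        mul_le_mul_of_nonneg_left (by simp only [x0]; linarith) (hl t).le
      have h3 : l t * (|(q t).eval 1| / l t + 1) = |(q t).eval 1| + l t := by
        have := hl t
        field_simp
      have h4 := neg_abs_le ((q t).eval 1)
      have h5 := hl t
      simp only [x]
      linarith
    let v' : ℕ → ℚ := fun i => if i = N + 1 then x else d t * v i
    have hv'1 : v' (N + 1) = x := if_pos rfl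
    have hv'2 : ∀ i, i ≠ N + 1 → v' i = d t * v i := fun i hi => if_neg hi
    refine ⟨v', ?_, ?_⟩
    · intro i
      by_cases hi : i = N + 1
      · rw [hi, hv'1]; exact hx
      · rw [hv'2 i hi]; exact mul_pos (hd t) (hv i)
    intro a ha 𝓘 hfam F hF
    obtain ⟨hne, hsub, hdisj⟩ := hfam
    have hIcc : ∀ I ∈ 𝓘, N + 1 ∉ I → I ⊆ Finset.Icc 1 N := by
      intro I hI hN i hi
      have h1 := Finset.mem_Icc.1 ((hsub I hI).2 hi)
      have h2 : i ≠ N + 1 := fun h => hN (h ▸ hi)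
      exact Finset.mem_Icc.2 ⟨h1.1, by omega⟩
    have hval : ∀ I ∈ 𝓘, N + 1 ∉ I → ∀ i ∈ I, a * v' i = a * d t * v i := by
      intro I hI hN i hi
      rw [hv'2 i (fun h => hN (h ▸ hi))]; ring
    by_cases hNF : N + 1 ∈ F
    · have hJ0 : ∀ I ∈ 𝓘.erase F, N + 1 ∉ I := by
        intro I hI hN
        obtain ⟨h1, h2⟩ := Finset.mem_erase.1 hI
        exact Finset.disjoint_left.1 (hdisj I h2 F hF.1 h1) hN hNF
      have hB : F.erase (N + 1) ⊆ Finset.Icc 1 N := by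
        intro i hi
        obtain ⟨h1, h2⟩ := Finset.mem_erase.1 hi
        have h3 := Finset.mem_Icc.1 ((hsub F hF.1).2 h2)
        exact Finset.mem_Icc.2 ⟨h3.1, by omega⟩
      have hBc : (F.erase (N + 1)).card < N + 1 := by
        have := Finset.card_le_card hB
        rw [Nat.card_Icc] at this
        omega
      have hJ : 𝓘.erase F ⊆ (Finset.Icc 1 N).powerset.erase ∅ := by
        intro I hI
        have h2 := Finset.mem_of_mem_erase hI
        refine Finset.mem_erase.2 ⟨(hsub I h2).1.ne_empty, Finset.mem_powerset.2 ?_⟩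
        exact hIcc I h2 (hJ0 I hI)
      have key := ht a ha _ hB hBc _ hJ x (by simp [x])
      rw [one_mul] at key
      have eF : ∏ i ∈ F, a * v' i = a ^ ((F.erase (N + 1)).card + 1) *
          d t ^ (F.erase (N + 1)).card * (∏ i ∈ F.erase (N + 1), v i) * x := by
        rw [← Finset.mul_prod_erase F _ hNF, hv'1]
        have : ∏ i ∈ F.erase (N + 1), a * v' i = ∏ i ∈ F.erase (N + 1), (a * d t) * v i := by
          refine Finset.prod_congr rfl fun i hi => ?_
          rw [hv'2 i (Finset.ne_of_mem_erase hi)]; ring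
        rw [this, Finset.prod_mul_distrib, Finset.prod_const]
        ring
      have eP : phi 𝓘 (fun i => a * v' i) = ∏ i ∈ F, a * v' i +
          phi (𝓘.erase F) (fun i => a * d t * v i) := by
        have h1 : phi (𝓘.erase F) (fun i => a * d t * v i) =
            phi (𝓘.erase F) (fun i => a * v' i) :=
          phi_congr fun I hI i hi =>
            (hval I (Finset.mem_of_mem_erase hI) (hJ0 I hI) i hi).symm
        rw [h1]
        exact (Finset.add_sum_erase 𝓘 (fun I => ∏ i ∈ I, a * v' i) hF.1).symm
      rw [eP, eF]
      exact key
    · have hN : ∀ I ∈ 𝓘, N + 1 ∉ I := by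
        intro I hI hN
        by_cases hIF : I = F
        · exact hNF (hIF ▸ hN)
        have h1 := hF.2 I hI hIF
        have h2 : ((N + 1 : ℕ) : WithBot ℕ) ≤ I.max := Finset.le_max hN
        have h3 : F.max ≤ ((N + 1 : ℕ) : WithBot ℕ) := by
          refine Finset.max_le fun i hi => ?_
          have := (Finset.mem_Icc.1 ((hsub F hF.1).2 hi)).2
          exact WithBot.coe_le_coe.2 this
        exact absurd (h2.trans_lt h1) (not_lt.2 h3)
      have h1 : phi 𝓘 (fun i => a * v' i) = phi 𝓘 (fun i => a * d t * v i) :=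
        phi_congr fun I hI => hval I hI (hN I hI)
      have h2 : ∏ i ∈ F, a * v' i = ∏ i ∈ F, a * d t * v i :=
        Finset.prod_congr rfl (hval F hF.1 hNF)
      rw [h1, h2]
      refine hcons (a * d t) (Finset.mem_image.2 ⟨(a, t), by simp [ha], rfl⟩) 𝓘
        ⟨hne, fun I hI => ⟨(hsub I hI).1, hIcc I hI (hN I hI)⟩, hdisj⟩ F hF

theorem all_consistent_vector_exists (r n : ℕ) (hr : 0 < r) (hn : 0 < n) :
    ∃ S : Finset ℚ, (∀ s ∈ S, 0 < s) ∧
      ∀ C : ℚ → Fin r,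
        ∃ v : ℕ → ℚ, (∀ i ∈ Finset.Icc 1 n, v i ∈ S) ∧
          ∀ 𝓘 : Finset (Finset ℕ), IsNFamily n 𝓘 →
            ∀ F : Finset ℕ, IsLeading 𝓘 F →
              phi 𝓘 v ∈ S ∧ (∏ i ∈ F, v i) ∈ S ∧
                C (phi 𝓘 v) = C (∏ i ∈ F, v i) := by
  classical
  let P : Finset (Finset ℕ) := (Finset.Icc 1 n).powerset
  let Fs : Finset (Finset (Finset ℕ) × Finset ℕ) :=
    (P.powerset ×ˢ P).filter (fun x => IsNFamily n x.1 ∧ IsLeading x.1 x.2)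
  have hFs : ∀ 𝓘 F, IsNFamily n 𝓘 → IsLeading 𝓘 F → (𝓘, F) ∈ Fs := by
    intro 𝓘 F h1 h2
    have h3 : 𝓘 ⊆ P := fun I hI => Finset.mem_powerset.2 (h1.2.1 I hI).2
    exact Finset.mem_filter.2
      ⟨Finset.mem_product.2 ⟨Finset.mem_powerset.2 h3, h3 h2.1⟩, h1, h2⟩
  obtain ⟨I, hI⟩ := compactness_eq (X := ℚ) (κ := Fin r) (ι := {v : ℕ → ℚ // ∀ i, 0 < v i})
    (fun v => Fs.image (fun x => (phi x.1 v.1, ∏ i ∈ x.2, v.1 i))) (by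
      intro C
      obtain ⟨v, hv, h⟩ := robust (Fin r) n {1} (by simp) C
      refine ⟨⟨v, hv⟩, ?_⟩
      intro e he
      obtain ⟨x, hx, rfl⟩ := Finset.mem_image.1 he
      obtain ⟨-, h1, h2⟩ := Finset.mem_filter.1 hx
      have := h 1 (by simp) x.1 h1 x.2 h2
      simpa only [one_mul] using this)
  refine ⟨I.biUnion (fun v => (Finset.Icc 1 n).image v.1 ∪
    (Fs.image (fun x => phi x.1 v.1) ∪ Fs.image (fun x => ∏ i ∈ x.2, v.1 i))), ?_, ?_⟩
  · intro s hs
    obtain ⟨v, -, hs⟩ := Finset.mem_biUnion.1 hs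
    rcases Finset.mem_union.1 hs with hs | hs
    · obtain ⟨i, -, rfl⟩ := Finset.mem_image.1 hs
      exact v.2 i
    rcases Finset.mem_union.1 hs with hs | hs
    · obtain ⟨x, hx, rfl⟩ := Finset.mem_image.1 hs
      obtain ⟨-, h1, h2⟩ := Finset.mem_filter.1 hx
      exact Finset.sum_pos (fun I _ => Finset.prod_pos fun i _ => v.2 i) h1.1
    · obtain ⟨x, hx, rfl⟩ := Finset.mem_image.1 hs
      exact Finset.prod_pos fun i _ => v.2 i
  · intro C
    obtain ⟨v, hv, h⟩ := hI C
    refine ⟨v.1, ?_, ?_⟩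
    · intro i hi
      exact Finset.mem_biUnion.2 ⟨v, hv, Finset.mem_union_left _ (Finset.mem_image_of_mem _ hi)⟩
    · intro 𝓘 h1 F h2
      have hm := hFs 𝓘 F h1 h2
      refine ⟨Finset.mem_biUnion.2 ⟨v, hv, Finset.mem_union_right _ (Finset.mem_union_left _
        (Finset.mem_image.2 ⟨_, hm, rfl⟩))⟩, Finset.mem_biUnion.2 ⟨v, hv,
        Finset.mem_union_right _ (Finset.mem_union_right _
        (Finset.mem_image.2 ⟨_, hm, rfl⟩))⟩, ?_⟩
      exact h _ (Finset.mem_image.2 ⟨_, hm, rfl⟩)
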